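/- Let p be a harmonic homogeneous polynomial of degree 4 in three real variables (Δp = 0), representing a harmonic fourth-order tensor H, and let d₂(p) be the symmetric 3×3 matrix with entries d₂(p)ᵢⱼ = Σ_{k,l,m} (∂ₖ∂ₗ∂ₘ∂ᵢ p)·(∂ₖ∂ₗ∂ₘ∂ⱼ p) (each fourth-order partial derivative of p being a constant), which realizes the covariant d₂ = tr₁₃(H²) up to a positive factor. Then the following are equivalent: (i) H is cubic or isotropic, i.e. there exists h ∈ SO(3) such that every element of h𝕆h⁻¹ fixes p; (ii) d₂(p) is a scalar multiple of the identity matrix. Moreover, H is isotropic (p = 0) precisely when d₂(p) = 0, and H is cubic precisely when d₂(p) is a nonzero scalar multiple of the identity. -/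

import Mathlib

open Matrix MvPolynomial

/-- The rotation group `SO(3)` as a set of real `3 × 3` matrices. -/
def SO3 : Set (Matrix (Fin 3) (Fin 3) ℝ) := {g | g * gᵀ = 1 ∧ g.det = 1}

/-- The octahedral subgroup `𝕆` of `SO(3)`: rotations sending each standard basis vector
to `±` a standard basis vector. -/
def Octa : Set (Matrix (Fin 3) (Fin 3) ℝ) :=
  {g | g ∈ SO3 ∧ ∀ i : Fin 3, ∃ j : Fin 3,
    g.mulVec (Pi.single i 1) = Pi.single j 1 ∨ g.mulVec (Pi.single i 1) = -Pi.single j 1}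

/-- The Laplacian of a polynomial in three variables. -/
noncomputable def lap (p : MvPolynomial (Fin 3) ℝ) : MvPolynomial (Fin 3) ℝ :=
  ∑ i, pderiv i (pderiv i p)

/-- `g ∈ SO(3)` fixes the polynomial `q`, i.e. `q(g⁻¹·x) = q(x)` for all `x`. -/
def fixesPoly (g : Matrix (Fin 3) (Fin 3) ℝ) (q : MvPolynomial (Fin 3) ℝ) : Prop :=
  ∀ x : Fin 3 → ℝ, eval (g⁻¹.mulVec x) q = eval x q

/-- The symmetric matrix `d₂(p)ᵢⱼ = Σ_{k,l,m} (∂ₖ∂ₗ∂ₘ∂ᵢ p)·(∂ₖ∂ₗ∂ₘ∂ⱼ p)` (the fourth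
derivatives of a quartic are constants), realizing `d₂ = tr₁₃(H²)` up to a positive
factor. -/
noncomputable def d2 (p : MvPolynomial (Fin 3) ℝ) : Matrix (Fin 3) (Fin 3) ℝ :=
  Matrix.of fun i j => ∑ k, ∑ l, ∑ m,
    (eval 0 (pderiv k (pderiv l (pderiv m (pderiv i p))))) *
    (eval 0 (pderiv k (pderiv l (pderiv m (pderiv j p)))))

/-- The polynomial `x ↦ p (h x)`. -/
noncomputable def rotPoly (h : Matrix (Fin 3) (Fin 3) ℝ) :
    MvPolynomial (Fin 3) ℝ →ₐ[ℝ] MvPolynomial (Fin 3) ℝ :=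
  aeval fun a => ∑ j, C (h a j) * X j

theorem eval_rotPoly (h : Matrix (Fin 3) (Fin 3) ℝ) (p : MvPolynomial (Fin 3) ℝ)
    (x : Fin 3 → ℝ) : eval x (rotPoly h p) = eval (h.mulVec x) p := by
  induction p using MvPolynomial.induction_on with
  | C a => simp [rotPoly]
  | add p q hp hq => simp [hp, hq]
  | mul_X p i hp =>
    rw [map_mul, map_mul, hp, map_mul]
    simp [rotPoly, Matrix.mulVec, dotProduct]

theorem isHomogeneous_rotPoly (h : Matrix (Fin 3) (Fin 3) ℝ) {p : MvPolynomial (Fin 3) ℝ} {n : ℕ}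
    (hp : p.IsHomogeneous n) : (rotPoly h p).IsHomogeneous n := by
  have := hp.aeval (fun a => ∑ j, C (h a j) * X j) (n := 1) fun a =>
    IsHomogeneous.sum _ _ _ fun j _ => by
      simpa using (isHomogeneous_C (Fin 3) (h a j)).mul (isHomogeneous_X ℝ j)
  simpa [rotPoly] using this

theorem pderiv_rotPoly (h : Matrix (Fin 3) (Fin 3) ℝ) (p : MvPolynomial (Fin 3) ℝ) (i : Fin 3) :
    pderiv i (rotPoly h p) = ∑ a, h a i • rotPoly h (pderiv a p) := by
  induction p using MvPolynomial.induction_on with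
  | C a => simp [rotPoly]
  | add p q hp hq => simp [hp, hq, Finset.sum_add_distrib]
  | mul_X p k hp =>
    have hX : pderiv i (rotPoly h (X k)) = C (h k i) := by
      simp [rotPoly, pderiv_X, Pi.single_apply]
    simp only [map_mul, pderiv_mul, hp, hX, map_add, smul_add, Finset.sum_add_distrib,
      Finset.sum_mul, smul_mul_assoc]
    congr 1
    simp [pderiv_X, Pi.single_apply, apply_ite (rotPoly h), smul_eq_C_mul, mul_comm]

theorem pderiv_pderiv_comm (p : MvPolynomial (Fin 3) ℝ) (i j : Fin 3) :
    pderiv i (pderiv j p) = pderiv j (pderiv i p) := by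
  have h : ⁅pderiv (R := ℝ) i, pderiv j⁆ = (0 : Derivation ℝ (MvPolynomial (Fin 3) ℝ) _) :=
    derivation_ext fun k => by
      simp [Derivation.commutator_apply, pderiv_X, Pi.single_apply, apply_ite (pderiv (R := ℝ) _)]
  have := congrArg (fun D => D p) h
  simpa [Derivation.commutator_apply, sub_eq_zero] using this

theorem lap_rotPoly {h : Matrix (Fin 3) (Fin 3) ℝ} (hh : h * hᵀ = 1)
    (p : MvPolynomial (Fin 3) ℝ) : lap (rotPoly h p) = rotPoly h (lap p) := by
  have key : ∀ a b, ∑ i, h a i * h b i = if a = b then 1 else 0 := fun a b => by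
    simpa [Matrix.mul_apply, Matrix.one_apply] using congrFun (congrFun hh a) b
  simp only [lap, pderiv_rotPoly, map_sum, Derivation.map_smul, Finset.smul_sum, smul_smul]
  rw [Finset.sum_comm]
  refine Finset.sum_congr rfl fun a _ => ?_
  rw [Finset.sum_comm]
  simp [← Finset.sum_smul, key]

/-- The full contraction of the `n`-th derivatives of two polynomials at the origin. -/
noncomputable def derivInner :
    ℕ → MvPolynomial (Fin 3) ℝ →ₗ[ℝ] MvPolynomial (Fin 3) ℝ →ₗ[ℝ] ℝ
  | 0 => (LinearMap.mul ℝ ℝ).compl₁₂ (aeval (0 : Fin 3 → ℝ)).toLinearMap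
      (aeval (0 : Fin 3 → ℝ)).toLinearMap
  | n + 1 => ∑ k, (derivInner n).compl₁₂ (pderiv k).toLinearMap (pderiv k).toLinearMap

theorem derivInner_succ (n : ℕ) (f g : MvPolynomial (Fin 3) ℝ) :
    derivInner (n + 1) f g = ∑ k, derivInner n (pderiv k f) (pderiv k g) := by
  simp [derivInner]

theorem derivInner_zero (f g : MvPolynomial (Fin 3) ℝ) :
    derivInner 0 f g = eval 0 f * eval 0 g := by
  simp [derivInner]

theorem derivInner_rotPoly {h : Matrix (Fin 3) (Fin 3) ℝ} (hh : h * hᵀ = 1) (n : ℕ)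
    (f g : MvPolynomial (Fin 3) ℝ) :
    derivInner n (rotPoly h f) (rotPoly h g) = derivInner n f g := by
  have key : ∀ a b, ∑ i, h a i * h b i = if a = b then 1 else 0 := fun a b => by
    simpa [Matrix.mul_apply, Matrix.one_apply] using congrFun (congrFun hh a) b
  induction n generalizing f g with
  | zero => rw [derivInner_zero, derivInner_zero, eval_rotPoly, eval_rotPoly, Matrix.mulVec_zero]
  | succ n ih =>
    simp only [derivInner_succ, pderiv_rotPoly, map_sum, map_smul, LinearMap.sum_apply,
      LinearMap.smul_apply, ih, smul_eq_mul, Finset.mul_sum]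
    rw [Finset.sum_comm]
    refine Finset.sum_congr rfl fun a _ => ?_
    rw [Finset.sum_comm]
    simp only [← mul_assoc, ← Finset.sum_mul]
    simp [fun a b => (Finset.sum_congr rfl fun i _ => mul_comm (h b i) (h a i)).trans (key a b)]

theorem d2_apply (p : MvPolynomial (Fin 3) ℝ) (i j : Fin 3) :
    d2 p i j = derivInner 3 (pderiv i p) (pderiv j p) := by
  simp only [d2, Matrix.of_apply, derivInner_succ, derivInner_zero, Fin.sum_univ_three]
  ring

theorem d2_rotPoly {h : Matrix (Fin 3) (Fin 3) ℝ} (hh : h * hᵀ = 1)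
    (p : MvPolynomial (Fin 3) ℝ) : d2 (rotPoly h p) = hᵀ * d2 p * h := by
  ext i j
  simp only [d2_apply, pderiv_rotPoly, map_sum, map_smul, LinearMap.sum_apply,
    LinearMap.smul_apply, derivInner_rotPoly hh, Matrix.mul_apply, Matrix.transpose_apply,
    smul_eq_mul, Finset.mul_sum, Finset.sum_mul]
  exact Finset.sum_congr rfl fun a _ => Finset.sum_congr rfl fun b _ => by ring

/-- The fourth derivatives of a polynomial at the origin. -/
noncomputable def quarticTensor (p : MvPolynomial (Fin 3) ℝ) (i j k l : Fin 3) : ℝ :=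
  eval 0 (pderiv i (pderiv j (pderiv k (pderiv l p))))

theorem quarticTensor_swap₁₂ (p : MvPolynomial (Fin 3) ℝ) (i j k l : Fin 3) :
    quarticTensor p i j k l = quarticTensor p j i k l := by
  rw [quarticTensor, quarticTensor, pderiv_pderiv_comm]

theorem quarticTensor_swap₂₃ (p : MvPolynomial (Fin 3) ℝ) (i j k l : Fin 3) :
    quarticTensor p i j k l = quarticTensor p i k j l := by
  rw [quarticTensor, quarticTensor, pderiv_pderiv_comm _ j k]

theorem quarticTensor_swap₃₄ (p : MvPolynomial (Fin 3) ℝ) (i j k l : Fin 3) :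
    quarticTensor p i j k l = quarticTensor p i j l k := by
  rw [quarticTensor, quarticTensor, pderiv_pderiv_comm _ k l]

theorem quarticTensor_trace {p : MvPolynomial (Fin 3) ℝ} (hp : lap p = 0) (i j : Fin 3) :
    ∑ k, quarticTensor p i j k k = 0 := by
  have := congrArg (fun q => eval 0 (pderiv i (pderiv j q))) hp
  simpa [lap, quarticTensor] using this

theorem natCast_mul_eval_eq_sum_pderiv {p : MvPolynomial (Fin 3) ℝ} {n : ℕ}
    (hp : p.IsHomogeneous n) (x : Fin 3 → ℝ) :
    n * eval x p = ∑ i, x i * eval x (pderiv i p) := by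
  have := congrArg (eval x) hp.sum_X_mul_pderiv
  simpa using this.symm

theorem eval_eq_sum_quarticTensor {p : MvPolynomial (Fin 3) ℝ} (hp : p.IsHomogeneous 4)
    (x : Fin 3 → ℝ) :
    24 * eval x p = ∑ l, ∑ k, ∑ j, ∑ i, x l * x k * x j * x i * quarticTensor p i j k l := by
  have h0 : ∀ q : MvPolynomial (Fin 3) ℝ, q.IsHomogeneous 0 → eval x q = eval 0 q := by
    intro q hq
    rw [← totalDegree_zero_iff_isHomogeneous, totalDegree_eq_zero_iff_eq_C] at hq
    rw [hq]; simp
  have e1 := natCast_mul_eval_eq_sum_pderiv hp x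
  have e2 := fun l => natCast_mul_eval_eq_sum_pderiv (hp.pderiv (i := l)) x
  have e3 := fun l k => natCast_mul_eval_eq_sum_pderiv ((hp.pderiv (i := l)).pderiv (i := k)) x
  have e4 := fun l k j => natCast_mul_eval_eq_sum_pderiv
    (((hp.pderiv (i := l)).pderiv (i := k)).pderiv (i := j)) x
  have e5 := fun l k j i => h0 _ ((((hp.pderiv (i := l)).pderiv (i := k)).pderiv
    (i := j)).pderiv (i := i))
  norm_num at e1 e2 e3 e4
  calc 24 * eval x p = 6 * (4 * eval x p) := by ring
    _ = ∑ l, x l * (2 * (3 * eval x (pderiv l p))) := by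
      rw [e1, Finset.mul_sum]; exact Finset.sum_congr rfl fun _ _ => by ring
    _ = _ := by
      simp only [e2, Finset.mul_sum, quarticTensor]
      refine Finset.sum_congr rfl fun l _ => Finset.sum_congr rfl fun k _ => ?_
      rw [mul_left_comm 2, e3]
      simp only [e4, e5, Finset.mul_sum]
      exact Finset.sum_congr rfl fun _ _ => Finset.sum_congr rfl fun _ _ => by ring

theorem d2_diag (p : MvPolynomial (Fin 3) ℝ) (i : Fin 3) :
    d2 p i i = ∑ k, ∑ l, ∑ m, quarticTensor p k l m i ^ 2 := by
  simp [d2, quarticTensor, sq]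

theorem eq_zero_iff_d2_eq_zero {p : MvPolynomial (Fin 3) ℝ} (hp : p.IsHomogeneous 4) :
    p = 0 ↔ d2 p = 0 := by
  constructor
  · rintro rfl
    ext i j
    simp [d2]
  · intro h
    have hT : ∀ k l m i, quarticTensor p k l m i = 0 := by
      intro k l m i
      have h1 : d2 p i i = 0 := by simp [h]
      rw [d2_diag, Finset.sum_eq_zero_iff_of_nonneg fun _ _ => by positivity] at h1
      have h2 := h1 k (Finset.mem_univ _)
      rw [Finset.sum_eq_zero_iff_of_nonneg fun _ _ => by positivity] at h2
      have h3 := h2 l (Finset.mem_univ _)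
      rw [Finset.sum_eq_zero_iff_of_nonneg fun _ _ => by positivity] at h3
      simpa using h3 m (Finset.mem_univ _)
    refine MvPolynomial.funext fun x => ?_
    have := eval_eq_sum_quarticTensor hp x
    simp only [hT] at this
    simpa using this

theorem SO3.transpose_mul {g : Matrix (Fin 3) (Fin 3) ℝ} (hg : g ∈ SO3) : gᵀ * g = 1 :=
  mul_eq_one_comm.mp hg.1

theorem SO3.inv_eq {g : Matrix (Fin 3) (Fin 3) ℝ} (hg : g ∈ SO3) : g⁻¹ = gᵀ :=
  Matrix.inv_eq_right_inv hg.1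

theorem SO3.mul_mem {g h : Matrix (Fin 3) (Fin 3) ℝ} (hg : g ∈ SO3) (hh : h ∈ SO3) :
    g * h ∈ SO3 := by
  refine ⟨?_, by rw [det_mul, hg.2, hh.2, one_mul]⟩
  rw [Matrix.transpose_mul, Matrix.mul_assoc, ← Matrix.mul_assoc h, hh.1, Matrix.one_mul, hg.1]

theorem SO3.inv_mem {g : Matrix (Fin 3) (Fin 3) ℝ} (hg : g ∈ SO3) : g⁻¹ ∈ SO3 := by
  rw [SO3.inv_eq hg]
  exact ⟨by rw [transpose_transpose]; exact SO3.transpose_mul hg, by rw [det_transpose, hg.2]⟩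

theorem SO3.isUnit_det {g : Matrix (Fin 3) (Fin 3) ℝ} (hg : g ∈ SO3) : IsUnit g.det := by
  rw [hg.2]; exact isUnit_one

theorem fixesPoly_conj {h : Matrix (Fin 3) (Fin 3) ℝ} (hh : h ∈ SO3)
    (g : Matrix (Fin 3) (Fin 3) ℝ) (p : MvPolynomial (Fin 3) ℝ) :
    fixesPoly (h * g * h⁻¹) p ↔ fixesPoly g (rotPoly h p) := by
  have hu := SO3.isUnit_det hh
  have hinv : (h * g * h⁻¹)⁻¹ = h * g⁻¹ * h⁻¹ := by
    rw [Matrix.mul_inv_rev, Matrix.mul_inv_rev, Matrix.nonsing_inv_nonsing_inv _ hu,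
      Matrix.mul_assoc]
  simp only [fixesPoly, eval_rotPoly, hinv, Matrix.mulVec_mulVec]
  constructor
  · intro H x
    simpa [Matrix.mulVec_mulVec, Matrix.mul_assoc, Matrix.nonsing_inv_mul _ hu]
      using H (h.mulVec x)
  · intro H x
    simpa [Matrix.mulVec_mulVec, Matrix.mul_assoc, Matrix.mul_nonsing_inv _ hu]
      using H (h⁻¹.mulVec x)

theorem d2_comm_of_fixesPoly {g : Matrix (Fin 3) (Fin 3) ℝ} (hg : g ∈ SO3)
    {q : MvPolynomial (Fin 3) ℝ} (hq : fixesPoly g q) : g * d2 q = d2 q * g := by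
  have h1 : rotPoly g⁻¹ q = q := MvPolynomial.funext fun x => by rw [eval_rotPoly, hq]
  have h2 := d2_rotPoly (SO3.inv_mem hg).1 q
  rw [h1, SO3.inv_eq hg, transpose_transpose] at h2
  conv_rhs => rw [h2]
  rw [Matrix.mul_assoc, SO3.transpose_mul hg, Matrix.mul_one]

theorem exists_d2_eq_smul_of_octa {q : MvPolynomial (Fin 3) ℝ}
    (hq : ∀ g ∈ Octa, fixesPoly g q) :
    ∃ r : ℝ, d2 q = r • (1 : Matrix (Fin 3) (Fin 3) ℝ) := by
  have m1 : (!![1, 0, 0; 0, -1, 0; 0, 0, -1] : Matrix (Fin 3) (Fin 3) ℝ) ∈ Octa := by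
    refine ⟨⟨?_, by simp [det_fin_three]⟩, fun i => ⟨i, ?_⟩⟩
    · ext i j; fin_cases i <;> fin_cases j <;> simp [Matrix.mul_apply, Fin.sum_univ_three]
    · fin_cases i
      · left; ext k; fin_cases k <;> simp
      · right; ext k; fin_cases k <;> simp
      · right; ext k; fin_cases k <;> simp
  have m2 : (!![-1, 0, 0; 0, -1, 0; 0, 0, 1] : Matrix (Fin 3) (Fin 3) ℝ) ∈ Octa := by
    refine ⟨⟨?_, by simp [det_fin_three]⟩, fun i => ⟨i, ?_⟩⟩
    · ext i j; fin_cases i <;> fin_cases j <;> simp [Matrix.mul_apply, Fin.sum_univ_three]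
    · fin_cases i
      · right; ext k; fin_cases k <;> simp
      · right; ext k; fin_cases k <;> simp
      · left; ext k; fin_cases k <;> simp
  have m3 : (!![0, 0, 1; 1, 0, 0; 0, 1, 0] : Matrix (Fin 3) (Fin 3) ℝ) ∈ Octa := by
    refine ⟨⟨?_, by simp [det_fin_three]⟩, fun i => ⟨i + 1, Or.inl ?_⟩⟩
    · ext i j; fin_cases i <;> fin_cases j <;> simp [Matrix.mul_apply, Fin.sum_univ_three]
    · fin_cases i <;> ext k <;> fin_cases k <;> simp
  have c1 := fun i j => congrFun (congrFun (d2_comm_of_fixesPoly m1.1 (hq _ m1)) i) j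
  have c2 := fun i j => congrFun (congrFun (d2_comm_of_fixesPoly m2.1 (hq _ m2)) i) j
  have c3 := fun i j => congrFun (congrFun (d2_comm_of_fixesPoly m3.1 (hq _ m3)) i) j
  generalize d2 q = M at *
  have e01 := c1 0 1
  have e10 := c1 1 0
  have e02 := c1 0 2
  have e20 := c1 2 0
  have e12 := c2 1 2
  have e21 := c2 2 1
  have f1 := c3 1 0
  have f2 := c3 2 1
  simp [Matrix.mul_apply, Fin.sum_univ_three] at e01 e10 e02 e20 e12 e21 f1 f2
  refine ⟨M 0 0, ?_⟩
  ext i j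
  fin_cases i <;> fin_cases j <;> simp <;> linarith

/-- The octahedral harmonic quartic. -/
noncomputable def cubicForm (x : Fin 3 → ℝ) : ℝ := ∑ i, x i ^ 4 - 3 / 5 * (∑ i, x i ^ 2) ^ 2

theorem SO3.sum_sq_mulVec {g : Matrix (Fin 3) (Fin 3) ℝ} (hg : g ∈ SO3) (x : Fin 3 → ℝ) :
    ∑ i, g.mulVec x i ^ 2 = ∑ i, x i ^ 2 := by
  have : g.mulVec x ⬝ᵥ g.mulVec x = x ⬝ᵥ x := by
    rw [Matrix.dotProduct_mulVec, Matrix.vecMul_mulVec, SO3.transpose_mul hg, Matrix.vecMul_one]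
  simpa [dotProduct, sq] using this

theorem SO3.sum_row_sq {g : Matrix (Fin 3) (Fin 3) ℝ} (hg : g ∈ SO3) (i : Fin 3) :
    ∑ j, g i j ^ 2 = 1 := by
  have := congrFun (congrFun hg.1 i) i
  simpa [Matrix.mul_apply, sq] using this

theorem cubicForm_inv_mulVec {g : Matrix (Fin 3) (Fin 3) ℝ} (hg : g ∈ Octa) (x : Fin 3 → ℝ) :
    cubicForm (g⁻¹.mulVec x) = cubicForm x := by
  rw [cubicForm, cubicForm, SO3.sum_sq_mulVec (SO3.inv_mem hg.1)]
  congr 1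
  have h1 : ∀ i, (g⁻¹.mulVec x i) ^ 4 = ∑ j, g j i ^ 2 * x j ^ 4 := by
    intro i
    obtain ⟨j, hj⟩ := hg.2 i
    have hcol : ∀ k, g k i = (Pi.single j 1 : Fin 3 → ℝ) k ∨
        g k i = -(Pi.single j 1 : Fin 3 → ℝ) k := fun k => by
      rcases hj with hj | hj
      · left; simpa using congrFun hj k
      · right; simpa using congrFun hj k
    have hz : ∀ k, k ≠ j → g k i = 0 := fun k hk => by simpa [hk] using hcol k
    have h0 : g j i = 1 ∨ g j i = -1 := by simpa using hcol j
    rw [SO3.inv_eq hg.1]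
    simp only [Matrix.mulVec, dotProduct, Matrix.transpose_apply]
    rw [Finset.sum_eq_single j (fun k _ hk => by simp [hz k hk]) (by simp),
      Finset.sum_eq_single j (fun k _ hk => by simp [hz k hk]) (by simp)]
    rcases h0 with h0 | h0 <;> rw [h0] <;> ring
  simp only [h1]
  rw [Finset.sum_comm]
  simp only [← Finset.sum_mul, SO3.sum_row_sq hg.1, one_mul]

theorem exists_eq_single_of_sum_pow_four {v : Fin 3 → ℝ} (h2 : ∑ i, v i ^ 2 = 1)
    (h4 : ∑ i, v i ^ 4 = 1) : ∃ j, v = Pi.single j 1 ∨ v = -Pi.single j 1 := by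
  have hle : ∀ i, v i ^ 2 ≤ 1 := fun i => by
    rw [← h2]
    exact Finset.single_le_sum (f := fun i => v i ^ 2) (fun _ _ => sq_nonneg _)
      (Finset.mem_univ i)
  have hs : ∑ i, v i ^ 2 * (1 - v i ^ 2) = 0 := by
    have : ∀ i, v i ^ 2 * (1 - v i ^ 2) = v i ^ 2 - v i ^ 4 := fun i => by ring
    simp only [this, Finset.sum_sub_distrib, h2, h4, sub_self]
  rw [Finset.sum_eq_zero_iff_of_nonneg fun i _ =>
    mul_nonneg (sq_nonneg _) (sub_nonneg.2 (hle i))] at hs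
  obtain ⟨j, hj⟩ : ∃ j, v j ≠ 0 := by
    by_contra! h
    simp [h] at h2
  have hj1 : v j ^ 2 = 1 := by
    have := hs j (Finset.mem_univ j)
    simp only [mul_eq_zero, pow_eq_zero_iff, ne_eq, OfNat.ofNat_ne_zero, not_false_eq_true,
      hj, false_or] at this
    linarith
  have hz : ∀ k, k ≠ j → v k = 0 := by
    rw [← Finset.add_sum_erase _ _ (Finset.mem_univ j), hj1] at h2
    have h0 : ∑ k ∈ Finset.univ.erase j, v k ^ 2 = 0 := by linarith
    rw [Finset.sum_eq_zero_iff_of_nonneg fun _ _ => sq_nonneg _] at h0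
    intro k hk
    simpa using h0 k (by simp [hk])
  refine ⟨j, ?_⟩
  rcases mul_self_eq_one_iff.mp ((sq (v j)).symm.trans hj1) with h | h
  · left
    ext k
    by_cases hk : k = j <;> simp [hk, h, hz]
  · right
    ext k
    by_cases hk : k = j <;> simp [hk, h, hz]

theorem mem_Octa_of_cubicForm {g : Matrix (Fin 3) (Fin 3) ℝ} (hg : g ∈ SO3)
    (H : ∀ x, cubicForm (g⁻¹.mulVec x) = cubicForm x) : g ∈ Octa := by
  refine ⟨hg, fun i => exists_eq_single_of_sum_pow_four ?_ ?_⟩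
  · rw [SO3.sum_sq_mulVec hg]; simp [Pi.single_apply, ite_pow]
  · have := H (g.mulVec (Pi.single i 1))
    rw [Matrix.mulVec_mulVec, Matrix.nonsing_inv_mul _ (SO3.isUnit_det hg), Matrix.one_mulVec,
      cubicForm, cubicForm, SO3.sum_sq_mulVec hg] at this
    have h1 : ∑ k, (Pi.single i 1 : Fin 3 → ℝ) k ^ 4 = 1 := by simp [Pi.single_apply, ite_pow]
    linarith

theorem exists_mem_SO3_notMem_Octa : ∃ g ∈ SO3, g ∉ Octa := by
  refine ⟨!![3 / 5, -4 / 5, 0; 4 / 5, 3 / 5, 0; 0, 0, 1], ⟨?_, ?_⟩, fun h => ?_⟩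
  · ext i j
    fin_cases i <;> fin_cases j <;> simp [Matrix.mul_apply, Fin.sum_univ_three] <;> norm_num
  · simp [det_fin_three]; norm_num
  · obtain ⟨j, hj⟩ := h.2 0
    rcases hj with hj | hj <;> have := congrFun hj 0 <;> fin_cases j <;>
      simp at this <;> norm_num at this

theorem isCompact_SO3 : IsCompact SO3 := by
  have hsub : SO3 ⊆ {g : Matrix (Fin 3) (Fin 3) ℝ | ∀ i j, g i j ∈ Set.Icc (-1 : ℝ) 1} := by
    intro g hg i j
    rw [Set.mem_Icc, ← abs_le, ← sq_le_one_iff_abs_le_one, ← SO3.sum_row_sq hg i]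
    exact Finset.single_le_sum (f := fun j => g i j ^ 2) (fun _ _ => sq_nonneg _)
      (Finset.mem_univ j)
  have hcomp : IsCompact {g : Matrix (Fin 3) (Fin 3) ℝ | ∀ i j, g i j ∈ Set.Icc (-1 : ℝ) 1} := by
    have := isCompact_univ_pi fun _ : Fin 3 =>
      isCompact_univ_pi fun _ : Fin 3 => isCompact_Icc (a := (-1 : ℝ)) (b := 1)
    simp only [Set.pi, Set.mem_univ, true_imp_iff, Set.mem_ofPred_eq] at this
    exact this
  refine hcomp.of_isClosed_subset ?_ hsub
  exact (isClosed_eq (by fun_prop) continuous_const).inter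
    (isClosed_eq (by fun_prop) continuous_const)

theorem one_mem_SO3 : (1 : Matrix (Fin 3) (Fin 3) ℝ) ∈ SO3 := ⟨by simp, by simp⟩

theorem exists_SO3_max (p : MvPolynomial (Fin 3) ℝ) (x : Fin 3 → ℝ) :
    ∃ h ∈ SO3, ∀ g ∈ SO3, eval (g.mulVec x) (rotPoly h p) ≤ eval x (rotPoly h p) := by
  have hc : Continuous fun h : Matrix (Fin 3) (Fin 3) ℝ => eval (h.mulVec x) p :=
    (MvPolynomial.continuous_eval p).comp (by fun_prop)
  obtain ⟨h, hh, hmax⟩ := isCompact_SO3.exists_isMaxOn ⟨1, one_mem_SO3⟩ hc.continuousOn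
  refine ⟨h, hh, fun g hg => ?_⟩
  rw [eval_rotPoly, eval_rotPoly, Matrix.mulVec_mulVec]
  exact hmax (SO3.mul_mem hh hg)

theorem eval_smul_of_isHomogeneous {q : MvPolynomial (Fin 3) ℝ} (hq : q.IsHomogeneous 4) (c : ℝ)
    (x : Fin 3 → ℝ) : eval (c • x) q = c ^ 4 * eval x q := by
  have h1 := eval_eq_sum_quarticTensor hq (c • x)
  have h2 := eval_eq_sum_quarticTensor hq x
  have h3 : 24 * eval (c • x) q = c ^ 4 * (24 * eval x q) := by
    rw [h1, h2]
    simp only [Finset.mul_sum, Pi.smul_apply, smul_eq_mul]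
    refine Finset.sum_congr rfl fun _ _ => Finset.sum_congr rfl fun _ _ =>
      Finset.sum_congr rfl fun _ _ => Finset.sum_congr rfl fun _ _ => by ring
  linarith

theorem eval_le_of_max {q : MvPolynomial (Fin 3) ℝ} (hq : q.IsHomogeneous 4)
    (hmax : ∀ g ∈ SO3, eval (g.mulVec ![0, 0, 1]) q ≤ eval ![0, 0, 1] q) {u v : ℝ}
    (huv : u ^ 2 + v ^ 2 = 1) (s : ℝ) :
    eval ![u * s, v * s, 1] q ≤ (1 + s ^ 2) ^ 2 * eval ![0, 0, 1] q := by
  have hpos : 0 < 1 + s ^ 2 := by positivity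
  set n := √(1 + s ^ 2) with hn
  have hn0 : n ≠ 0 := (Real.sqrt_pos.2 hpos).ne'
  have hn2 : n ^ 2 = 1 + s ^ 2 := Real.sq_sqrt hpos.le
  have hmem : !![u * (1 / n), -v, u * (s / n); v * (1 / n), u, v * (s / n); -(s / n), 0, 1 / n]
      ∈ SO3 := by
    have h1 : (1 / n) ^ 2 + (s / n) ^ 2 = 1 := by field_simp; linarith
    generalize 1 / n = k at h1
    generalize s / n = l at h1
    refine ⟨?_, ?_⟩
    · ext i j
      fin_cases i <;> fin_cases j <;> simp [Matrix.mul_apply, Fin.sum_univ_three]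
      · linear_combination u ^ 2 * h1 + huv
      · linear_combination u * v * h1
      · ring
      · linear_combination u * v * h1
      · linear_combination v ^ 2 * h1 + huv
      · ring
      · ring
      · ring
      · linear_combination h1
    · simp [det_fin_three]
      linear_combination h1 + (k ^ 2 + l ^ 2) * huv
  have h1 := hmax _ hmem
  have h2 : (![u * s, v * s, 1] : Fin 3 → ℝ) = n • (!![u * (1 / n), -v, u * (s / n);
      v * (1 / n), u, v * (s / n); -(s / n), 0, 1 / n].mulVec ![0, 0, 1]) := by
    ext i
    fin_cases i <;> simp <;> field_simp
  rw [h2, eval_smul_of_isHomogeneous hq, show n ^ 4 = (1 + s ^ 2) ^ 2 by rw [← hn2]; ring]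
  exact mul_le_mul_of_nonneg_left h1 (by positivity)

theorem coeff_of_quartic_nonpos {A B C D : ℝ}
    (h : ∀ s : ℝ, A * s + B * s ^ 2 + C * s ^ 3 + D * s ^ 4 ≤ 0) : A = 0 ∧ B ≤ 0 := by
  have key : ∀ f : ℝ → ℝ, Continuous f → (∀ s > 0, s * f s ≤ 0) → f 0 ≤ 0 := by
    intro f hf hs
    have ht : Filter.Tendsto f (nhdsWithin 0 (Set.Ioi 0)) (nhds (f 0)) :=
      (hf.tendsto 0).mono_left nhdsWithin_le_nhds
    refine le_of_tendsto ht ?_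
    filter_upwards [self_mem_nhdsWithin] with s hs0
    exact nonpos_of_mul_nonpos_right (hs s hs0) hs0
  have hA : A ≤ 0 := by
    simpa using key (fun s => A + s * (B + s * (C + s * D))) (by fun_prop)
      fun s _ => by linarith [h s]
  have hA' : -A ≤ 0 := by
    simpa using key (fun s => -A + s * (B - s * (C - s * D))) (by fun_prop)
      fun s _ => by linarith [h (-s)]
  have hA0 : A = 0 := by linarith
  refine ⟨hA0, ?_⟩
  subst hA0
  simpa using key (fun s => B + s * (C + s * D)) (by fun_prop) fun s hs => by
    have : s * (s * (B + s * (C + s * D))) ≤ 0 := by linarith [h s]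
    exact nonpos_of_mul_nonpos_right this hs

theorem exists_norm_one_mul_pow (z : ℂ) {m : ℕ} (hm : 0 < m) :
    ∃ w : ℂ, ‖w‖ = 1 ∧ z * w ^ m = ‖z‖ := by
  rcases eq_or_ne z 0 with rfl | hz
  · exact ⟨1, by simp⟩
  · have hz' : (‖z‖ : ℂ) ≠ 0 := by simpa using hz
    obtain ⟨w, hw⟩ := IsAlgClosed.exists_pow_nat_eq ((‖z‖ : ℂ) / z) hm
    refine ⟨w, ?_, by rw [hw]; field_simp⟩
    have : ‖w‖ ^ m = 1 := by rw [← norm_pow, hw]; simp [hz]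
    exact (pow_eq_one_iff_of_nonneg (norm_nonneg _) hm.ne').mp this

/-- The phase of `a - b i` can be cancelled by the `m`-th power of a unit complex number. -/
theorem exists_phase (a b : ℝ) {m : ℕ} (hm : 0 < m) :
    ∃ w : ℂ, w.re ^ 2 + w.im ^ 2 = 1 ∧ a * (w ^ m).re + b * (w ^ m).im = √(a ^ 2 + b ^ 2) ∧
      a * (w ^ m).im - b * (w ^ m).re = 0 := by
  obtain ⟨w, hw, h⟩ := exists_norm_one_mul_pow ⟨a, -b⟩ hm
  refine ⟨w, ?_, ?_, ?_⟩
  · rw [Complex.norm_eq_sqrt_sq_add_sq, Real.sqrt_eq_one] at hw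
    exact hw
  · have := congrArg Complex.re h
    simpa [Complex.norm_eq_sqrt_sq_add_sq] using this
  · have := congrArg Complex.im h
    simp at this
    linarith

theorem eq_zero_of_sq_add_sq_eq_zero {a b : ℝ} (h : a ^ 2 + b ^ 2 = 0) : a = 0 ∧ b = 0 := by
  simpa using (add_eq_zero_iff_of_nonneg (sq_nonneg a) (sq_nonneg b)).mp h

theorem quartic_parameters_dichotomy {t a b c d e f : ℝ} (h1 : 8 * (a * e + b * f) = -15 * a * t)
    (h2 : 8 * (b * e - a * f) = 15 * b * t)
    (h3 : 5 * a * c + 5 * b * d + 4 * c * e + 4 * d * f = 0)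
    (h4 : 5 * a * d - 5 * b * c + 4 * c * f - 4 * d * e = 0)
    (h5 : -4 * a ^ 2 - 4 * b ^ 2 + 4 * c ^ 2 + 4 * d ^ 2 + 8 * e ^ 2 + 8 * f ^ 2 = 25 / 8 * t ^ 2)
    (hB : ∀ u v : ℝ, u ^ 2 + v ^ 2 = 1 →
      (-t / 2 + a) * u ^ 2 + 2 * b * (u * v) + (-t / 2 - a) * v ^ 2 ≤ t / 3) :
    a = 0 ∧ b = 0 ∧ 0 ≤ t ∧ ((c = 0 ∧ d = 0 ∧ √(e ^ 2 + f ^ 2) = 5 / 8 * t) ∨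
      (e = 0 ∧ f = 0 ∧ √(c ^ 2 + d ^ 2) = 5 / 8 * √2 * t)) := by
  obtain ⟨w, hw, hre, -⟩ := exists_phase a b two_pos
  have hNle : √(a ^ 2 + b ^ 2) ≤ 5 / 6 * t := by
    have := hB _ _ hw
    simp only [sq w, Complex.mul_re, Complex.mul_im] at hre
    have hwt : -t / 2 * (w.re ^ 2 + w.im ^ 2) = -t / 2 := by rw [hw, mul_one]
    linarith
  have hN0 := Real.sqrt_nonneg (a ^ 2 + b ^ 2)
  have hN2 : √(a ^ 2 + b ^ 2) ^ 2 = a ^ 2 + b ^ 2 := Real.sq_sqrt (by positivity)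
  have ht : 0 ≤ t := by linarith
  have hle : a ^ 2 + b ^ 2 ≤ 25 / 36 * t ^ 2 := by
    rw [← hN2, show 25 / 36 * t ^ 2 = (5 / 6 * t) ^ 2 by ring]
    exact pow_le_pow_left₀ hN0 hNle 2
  have hprod : (a ^ 2 + b ^ 2) * (64 * (e ^ 2 + f ^ 2) - 225 * t ^ 2) = 0 := by
    linear_combination (8 * (a * e + b * f) + -15 * a * t) * h1 +
      (8 * (b * e - a * f) + 15 * b * t) * h2
  have hab : a ^ 2 + b ^ 2 = 0 := by
    rcases mul_eq_zero.mp hprod with h | h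
    · exact h
    · linarith [sq_nonneg c, sq_nonneg d, sq_nonneg t, sq_nonneg a, sq_nonneg b]
  obtain ⟨ha, hb⟩ := eq_zero_of_sq_add_sq_eq_zero hab
  subst ha hb
  refine ⟨rfl, rfl, ht, ?_⟩
  have hce : (c ^ 2 + d ^ 2) * (e ^ 2 + f ^ 2) = 0 := by
    linear_combination (c * e + d * f) / 4 * h3 + (c * f - d * e) / 4 * h4
  rcases mul_eq_zero.mp hce with h | h
  · obtain ⟨hc, hd⟩ := eq_zero_of_sq_add_sq_eq_zero h
    refine Or.inl ⟨hc, hd, ?_⟩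
    rw [Real.sqrt_eq_iff_mul_self_eq (by positivity) (by positivity)]
    subst hc hd
    linarith
  · obtain ⟨he, hf⟩ := eq_zero_of_sq_add_sq_eq_zero h
    refine Or.inr ⟨he, hf, ?_⟩
    rw [Real.sqrt_eq_iff_mul_self_eq (by positivity) (by positivity)]
    subst he hf
    have : √2 * √2 = (2 : ℝ) := Real.mul_self_sqrt (by norm_num)
    linear_combination h5 / 4 - 25 / 64 * t ^ 2 * this

theorem eval_eq_quarticTensor {q : MvPolynomial (Fin 3) ℝ} (hq : q.IsHomogeneous 4) (x y z : ℝ) :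
    24 * eval ![x, y, z] q =
      quarticTensor q 2 2 2 2 * z ^ 4 +
      4 * z ^ 3 * (quarticTensor q 0 2 2 2 * x + quarticTensor q 1 2 2 2 * y) +
      6 * z ^ 2 * (quarticTensor q 0 0 2 2 * x ^ 2 + 2 * quarticTensor q 0 1 2 2 * (x * y) +
        quarticTensor q 1 1 2 2 * y ^ 2) +
      4 * z * (quarticTensor q 0 0 0 2 * x ^ 3 + 3 * quarticTensor q 0 0 1 2 * (x ^ 2 * y) +
        3 * quarticTensor q 0 1 1 2 * (x * y ^ 2) + quarticTensor q 1 1 1 2 * y ^ 3) +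
      (quarticTensor q 0 0 0 0 * x ^ 4 + 4 * quarticTensor q 0 0 0 1 * (x ^ 3 * y) +
        6 * quarticTensor q 0 0 1 1 * (x ^ 2 * y ^ 2) + 4 * quarticTensor q 0 1 1 1 * (x * y ^ 3) +
        quarticTensor q 1 1 1 1 * y ^ 4) := by
  rw [eval_eq_sum_quarticTensor hq]
  simp only [Fin.sum_univ_three, Matrix.cons_val]
  simp only [quarticTensor_swap₁₂ q 1 0, quarticTensor_swap₁₂ q 2 0, quarticTensor_swap₁₂ q 2 1,
    quarticTensor_swap₂₃ q _ 1 0, quarticTensor_swap₂₃ q _ 2 0, quarticTensor_swap₂₃ q _ 2 1,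
    quarticTensor_swap₃₄ q _ _ 1 0, quarticTensor_swap₃₄ q _ _ 2 0, quarticTensor_swap₃₄ q _ _ 2 1]
  ring

theorem d2_eq_sum_quarticTensor (q : MvPolynomial (Fin 3) ℝ) (i j : Fin 3) :
    d2 q i j = ∑ k, ∑ l, ∑ m, quarticTensor q k l m i * quarticTensor q k l m j := rfl

theorem quarticTensor_eq_zero_and_le_of_max {q : MvPolynomial (Fin 3) ℝ} (hq : q.IsHomogeneous 4)
    (hmax : ∀ g ∈ SO3, eval (g.mulVec ![0, 0, 1]) q ≤ eval ![0, 0, 1] q) {u v : ℝ}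
    (huv : u ^ 2 + v ^ 2 = 1) :
    quarticTensor q 0 2 2 2 * u + quarticTensor q 1 2 2 2 * v = 0 ∧
      quarticTensor q 0 0 2 2 * u ^ 2 + 2 * quarticTensor q 0 1 2 2 * (u * v) +
        quarticTensor q 1 1 2 2 * v ^ 2 ≤ quarticTensor q 2 2 2 2 / 3 := by
  have key := fun s => eval_le_of_max hq hmax huv s
  have h0 := eval_eq_quarticTensor hq 0 0 1
  have hc := coeff_of_quartic_nonpos
    (A := 4 * (quarticTensor q 0 2 2 2 * u + quarticTensor q 1 2 2 2 * v))
    (B := 6 * (quarticTensor q 0 0 2 2 * u ^ 2 + 2 * quarticTensor q 0 1 2 2 * (u * v) +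
        quarticTensor q 1 1 2 2 * v ^ 2) - 2 * quarticTensor q 2 2 2 2)
    (C := 4 * (quarticTensor q 0 0 0 2 * u ^ 3 + 3 * quarticTensor q 0 0 1 2 * (u ^ 2 * v) +
        3 * quarticTensor q 0 1 1 2 * (u * v ^ 2) + quarticTensor q 1 1 1 2 * v ^ 3))
    (D := (quarticTensor q 0 0 0 0 * u ^ 4 + 4 * quarticTensor q 0 0 0 1 * (u ^ 3 * v) +
        6 * quarticTensor q 0 0 1 1 * (u ^ 2 * v ^ 2) + 4 * quarticTensor q 0 1 1 1 * (u * v ^ 3) +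
        quarticTensor q 1 1 1 1 * v ^ 4) - quarticTensor q 2 2 2 2)
    fun s => by
      have h1 := eval_eq_quarticTensor hq (u * s) (v * s) 1
      have h2 : 24 * eval ![u * s, v * s, 1] q ≤ (1 + s ^ 2) ^ 2 * (24 * eval ![0, 0, 1] q) := by
        linarith [key s]
      rw [h0, h1] at h2
      linarith
  exact ⟨by linarith [hc.1], by linarith [hc.2]⟩

set_option maxHeartbeats 1000000 in
theorem exists_quartic_parameters {q : MvPolynomial (Fin 3) ℝ} (hq : q.IsHomogeneous 4)
    (hlap : lap q = 0) {r : ℝ} (hd : d2 q = r • (1 : Matrix (Fin 3) (Fin 3) ℝ))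
    (hmax : ∀ g ∈ SO3, eval (g.mulVec ![0, 0, 1]) q ≤ eval ![0, 0, 1] q) :
    ∃ t a b c d e f : ℝ, 8 * (a * e + b * f) = -15 * a * t ∧
      8 * (b * e - a * f) = 15 * b * t ∧
      5 * a * c + 5 * b * d + 4 * c * e + 4 * d * f = 0 ∧
      5 * a * d - 5 * b * c + 4 * c * f - 4 * d * e = 0 ∧
      -4 * a ^ 2 - 4 * b ^ 2 + 4 * c ^ 2 + 4 * d ^ 2 + 8 * e ^ 2 + 8 * f ^ 2 = 25 / 8 * t ^ 2 ∧
      (∀ u v : ℝ, u ^ 2 + v ^ 2 = 1 →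
        (-t / 2 + a) * u ^ 2 + 2 * b * (u * v) + (-t / 2 - a) * v ^ 2 ≤ t / 3) ∧
      ∀ x y z : ℝ, 24 * eval ![x, y, z] q = t * z ^ 4 +
        6 * z ^ 2 * ((-t / 2 + a) * x ^ 2 + 2 * b * (x * y) + (-t / 2 - a) * y ^ 2) +
        4 * z * (c * (x ^ 3 - 3 * x * y ^ 2) + d * (3 * x ^ 2 * y - y ^ 3)) +
        ((3 * t / 8 - a + e) * x ^ 4 + 4 * (-b / 2 + f) * (x ^ 3 * y) +
          6 * (t / 8 - e) * (x ^ 2 * y ^ 2) + 4 * (-b / 2 - f) * (x * y ^ 3) +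
          (3 * t / 8 + a + e) * y ^ 4) := by
  have hx := quarticTensor_eq_zero_and_le_of_max hq hmax (u := 1) (v := 0) (by norm_num)
  have hy := quarticTensor_eq_zero_and_le_of_max hq hmax (u := 0) (v := 1) (by norm_num)
  have hB := fun u v (h : u ^ 2 + v ^ 2 = 1) =>
    (quarticTensor_eq_zero_and_le_of_max hq hmax h).2
  have heval := eval_eq_quarticTensor hq
  have hD := fun i j => (d2_eq_sum_quarticTensor q i j).symm.trans (congrFun (congrFun hd i) j)
  have hT := quarticTensor_trace hlap
  have t22 := hT 2 2
  have t02 := hT 0 2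
  have t12 := hT 1 2
  have t00 := hT 0 0
  have t11 := hT 1 1
  have t01 := hT 0 1
  have d00 := hD 0 0
  have d11 := hD 1 1
  have d22 := hD 2 2
  have d01 := hD 0 1
  have d02 := hD 0 2
  have d12 := hD 1 2
  have z1 : quarticTensor q 0 2 2 2 = 0 := by linarith [hx.1]
  have z2 : quarticTensor q 1 2 2 2 = 0 := by linarith [hy.1]
  simp only [Matrix.smul_apply, Matrix.one_apply, Fin.isValue, Fin.reduceEq, ite_true, ite_false,
    smul_eq_mul, mul_one, mul_zero] at d00 d01 d02 d11 d12 d22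
  clear hD hT hx hy hmax hd
  simp only [Fin.sum_univ_three, quarticTensor_swap₁₂ q 1 0, quarticTensor_swap₁₂ q 2 0,
    quarticTensor_swap₁₂ q 2 1, quarticTensor_swap₂₃ q _ 1 0, quarticTensor_swap₂₃ q _ 2 0,
    quarticTensor_swap₂₃ q _ 2 1, quarticTensor_swap₃₄ q _ _ 1 0, quarticTensor_swap₃₄ q _ _ 2 0,
    quarticTensor_swap₃₄ q _ _ 2 1, z1, z2] at *
  generalize quarticTensor q 2 2 2 2 = t at *
  generalize quarticTensor q 0 0 2 2 = k1 at *
  generalize quarticTensor q 0 1 2 2 = b at *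
  generalize quarticTensor q 1 1 2 2 = k2 at *
  generalize quarticTensor q 0 0 0 2 = c at *
  generalize quarticTensor q 0 0 1 2 = d at *
  generalize quarticTensor q 0 1 1 2 = c' at *
  generalize quarticTensor q 1 1 1 2 = d' at *
  generalize quarticTensor q 0 0 0 0 = l1 at *
  generalize quarticTensor q 0 0 0 1 = m1 at *
  generalize quarticTensor q 0 0 1 1 = l at *
  generalize quarticTensor q 0 1 1 1 = m2 at *
  generalize quarticTensor q 1 1 1 1 = l2 at *
  obtain ⟨a, rfl⟩ : ∃ a, k1 = -t / 2 + a := ⟨k1 + t / 2, by ring⟩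
  obtain ⟨e, rfl⟩ : ∃ e, l = t / 8 - e := ⟨t / 8 - l, by ring⟩
  obtain ⟨f, rfl⟩ : ∃ f, m1 = -b / 2 + f := ⟨m1 + b / 2, by ring⟩
  obtain rfl : k2 = -t / 2 - a := by linarith
  obtain rfl : c' = -c := by linarith
  obtain rfl : d' = -d := by linarith
  obtain rfl : l1 = 3 * t / 8 - a + e := by linarith
  obtain rfl : l2 = 3 * t / 8 + a + e := by linarith
  obtain rfl : m2 = -b / 2 - f := by linarith
  refine ⟨t, a, b, c, d, e, f, ?_, ?_, ?_, ?_, ?_, hB, fun x y z => ?_⟩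
  · linear_combination 2 * (d11 - d00)
  · linear_combination 4 * d01
  · linear_combination d02
  · linear_combination d12
  · linear_combination d00 + d11 - 2 * d22
  · rw [heval]; ring

/-- The rotation about the third axis taking `x + i y` to `w (x + i y)`. -/
noncomputable def rotZ (w : ℂ) : Matrix (Fin 3) (Fin 3) ℝ :=
  !![w.re, -w.im, 0; w.im, w.re, 0; 0, 0, 1]

theorem rotZ_mem_SO3 {w : ℂ} (hw : w.re ^ 2 + w.im ^ 2 = 1) : rotZ w ∈ SO3 := by
  refine ⟨?_, ?_⟩
  · ext i j
    fin_cases i <;> fin_cases j <;>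
      simp [rotZ, Matrix.mul_apply, Fin.sum_univ_three] <;> first | ring1 | linear_combination hw
  · rw [rotZ, Matrix.det_fin_three]
    simp
    linear_combination hw

theorem rotZ_mulVec (w : ℂ) (x : Fin 3 → ℝ) : (rotZ w).mulVec x =
    ![w.re * x 0 - w.im * x 1, w.im * x 0 + w.re * x 1, x 2] := by
  ext i
  fin_cases i <;> simp [rotZ, Matrix.mulVec, dotProduct, Fin.sum_univ_three, sub_eq_add_neg]

/-- The rotation taking the diagonal of the cube to the third axis. -/
noncomputable def rotDiagonal : Matrix (Fin 3) (Fin 3) ℝ :=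
  !![-(√2 * √3 / 3), √2 * √3 / 6, √2 * √3 / 6; 0, -(√2 / 2), √2 / 2; √3 / 3, √3 / 3, √3 / 3]

theorem rotDiagonal_mem_SO3 : rotDiagonal ∈ SO3 := by
  have h2 : √2 ^ 2 = (2 : ℝ) := Real.sq_sqrt (by norm_num)
  have h3 : √3 ^ 2 = (3 : ℝ) := Real.sq_sqrt (by norm_num)
  refine ⟨?_, ?_⟩
  · ext i j
    fin_cases i <;> fin_cases j <;>
      simp [rotDiagonal, Matrix.mul_apply, Fin.sum_univ_three] <;> ring_nf <;>
      simp only [h2, h3] <;> norm_num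
  · rw [rotDiagonal, Matrix.det_fin_three]
    simp
    ring_nf
    simp only [h2, h3]
    norm_num

theorem exists_cubicForm_of_max {q : MvPolynomial (Fin 3) ℝ} (hq : q.IsHomogeneous 4)
    (hlap : lap q = 0) {r : ℝ} (hd : d2 q = r • (1 : Matrix (Fin 3) (Fin 3) ℝ))
    (hmax : ∀ g ∈ SO3, eval (g.mulVec ![0, 0, 1]) q ≤ eval ![0, 0, 1] q) :
    ∃ h ∈ SO3, ∃ s : ℝ, ∀ x, eval (h.mulVec x) q = s * cubicForm x := by
  obtain ⟨t, a, b, c, d, e, f, h1, h2, h3, h4, h5, hB, heval⟩ :=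
    exists_quartic_parameters hq hlap hd hmax
  obtain ⟨rfl, rfl, -, ⟨rfl, rfl, hN⟩ | ⟨rfl, rfl, hN⟩⟩ :=
    quartic_parameters_dichotomy h1 h2 h3 h4 h5 hB
  · obtain ⟨w, hw, hre, him⟩ := exists_phase e f four_pos
    rw [hN] at hre
    simp only [show w ^ 4 = w * w * (w * w) by ring, Complex.mul_re, Complex.mul_im] at hre him
    refine ⟨rotZ w, rotZ_mem_SO3 hw, 5 / 48 * t, fun x => ?_⟩
    rw [rotZ_mulVec]
    have := heval (w.re * x 0 - w.im * x 1) (w.im * x 0 + w.re * x 1) (x 2)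
    have hρ : (w.re * x 0 - w.im * x 1) ^ 2 + (w.im * x 0 + w.re * x 1) ^ 2 =
        x 0 ^ 2 + x 1 ^ 2 := by linear_combination (x 0 ^ 2 + x 1 ^ 2) * hw
    have hρ2 := congrArg (· ^ 2) hρ
    simp only [cubicForm, Fin.sum_univ_three]
    linear_combination 1 / 24 * this + 1 / 24 * (3 / 8 * t) * hρ2 -
      1 / 24 * 3 * t * x 2 ^ 2 * hρ +
      1 / 24 * (x 0 ^ 4 - 6 * x 0 ^ 2 * x 1 ^ 2 + x 1 ^ 4) * hre -
      1 / 24 * (4 * x 0 ^ 3 * x 1 - 4 * x 0 * x 1 ^ 3) * him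
  · obtain ⟨w, hw, hre, him⟩ := exists_phase c d three_pos
    rw [hN] at hre
    simp only [show w ^ 3 = w * w * w by ring, Complex.mul_re, Complex.mul_im] at hre him
    refine ⟨rotZ w * rotDiagonal, SO3.mul_mem (rotZ_mem_SO3 hw) rotDiagonal_mem_SO3,
      -(5 / 32) * t, fun y => ?_⟩
    rw [← Matrix.mulVec_mulVec, rotZ_mulVec]
    have hx0 : (rotDiagonal.mulVec y) 0 = √2 * √3 / 6 * (-2 * y 0 + y 1 + y 2) := by
      simp [rotDiagonal, Matrix.mulVec, dotProduct, Fin.sum_univ_three]; ring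
    have hx1 : (rotDiagonal.mulVec y) 1 = √2 / 2 * (y 2 - y 1) := by
      simp [rotDiagonal, Matrix.mulVec, dotProduct, Fin.sum_univ_three]; ring
    have hx2 : (rotDiagonal.mulVec y) 2 = √3 / 3 * (y 0 + y 1 + y 2) := by
      simp [rotDiagonal, Matrix.mulVec, dotProduct, Fin.sum_univ_three]; ring
    generalize rotDiagonal.mulVec y = x at *
    have := heval (w.re * x 0 - w.im * x 1) (w.im * x 0 + w.re * x 1) (x 2)
    have hρ : (w.re * x 0 - w.im * x 1) ^ 2 + (w.im * x 0 + w.re * x 1) ^ 2 =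
        x 0 ^ 2 + x 1 ^ 2 := by linear_combination (x 0 ^ 2 + x 1 ^ 2) * hw
    have hρ2 := congrArg (· ^ 2) hρ
    have key : 24 * eval ![w.re * x 0 - w.im * x 1, w.im * x 0 + w.re * x 1, x 2] q =
        t * (x 2 ^ 2) ^ 2 - 3 * t * x 2 ^ 2 * (x 0 ^ 2 + x 1 ^ 2) +
          3 / 8 * t * (x 0 ^ 2 + x 1 ^ 2) ^ 2 +
          5 / 2 * t * (√2 * (x 2 * x 0)) * (x 0 ^ 2 - 3 * x 1 ^ 2) := by
      linear_combination this + 3 / 8 * t * hρ2 - 3 * t * x 2 ^ 2 * hρ +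
        4 * x 2 * (x 0 ^ 3 - 3 * x 0 * x 1 ^ 2) * hre -
        4 * x 2 * (3 * x 0 ^ 2 * x 1 - x 1 ^ 3) * him
    have h2 : √2 ^ 2 = (2 : ℝ) := Real.sq_sqrt (by norm_num)
    have h3 : √3 ^ 2 = (3 : ℝ) := Real.sq_sqrt (by norm_num)
    have e0 : x 0 ^ 2 = (-2 * y 0 + y 1 + y 2) ^ 2 / 6 := by
      rw [hx0, mul_pow, div_pow, mul_pow, h2, h3]; ring
    have e1 : x 1 ^ 2 = (y 2 - y 1) ^ 2 / 2 := by
      rw [hx1, mul_pow, div_pow, h2]; ring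
    have e2 : x 2 ^ 2 = (y 0 + y 1 + y 2) ^ 2 / 3 := by
      rw [hx2, mul_pow, div_pow, h3]; ring
    have e3 : √2 * (x 2 * x 0) = (y 0 + y 1 + y 2) * (-2 * y 0 + y 1 + y 2) / 3 := by
      rw [hx0, hx2]
      linear_combination (y 0 + y 1 + y 2) * (-2 * y 0 + y 1 + y 2) * √3 ^ 2 / 18 * h2 +
        (y 0 + y 1 + y 2) * (-2 * y 0 + y 1 + y 2) / 9 * h3
    rw [e0, e1, e2, e3] at key
    simp only [cubicForm, Fin.sum_univ_three]
    linear_combination 1 / 24 * key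

theorem d2_rotPoly_of_eq_smul {h : Matrix (Fin 3) (Fin 3) ℝ} (hh : h ∈ SO3)
    {p : MvPolynomial (Fin 3) ℝ} {r : ℝ} (hd : d2 p = r • (1 : Matrix (Fin 3) (Fin 3) ℝ)) :
    d2 (rotPoly h p) = r • (1 : Matrix (Fin 3) (Fin 3) ℝ) := by
  rw [d2_rotPoly hh.1, hd, mul_smul_comm, mul_one, smul_mul_assoc, SO3.transpose_mul hh]

theorem d2_eq_smul_of_rotPoly {h : Matrix (Fin 3) (Fin 3) ℝ} (hh : h ∈ SO3)
    {p : MvPolynomial (Fin 3) ℝ} {r : ℝ}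
    (hd : d2 (rotPoly h p) = r • (1 : Matrix (Fin 3) (Fin 3) ℝ)) :
    d2 p = r • (1 : Matrix (Fin 3) (Fin 3) ℝ) := by
  rw [d2_rotPoly hh.1] at hd
  calc d2 p = (h * hᵀ) * d2 p * (h * hᵀ) := by rw [hh.1, one_mul, mul_one]
    _ = h * (hᵀ * d2 p * h) * hᵀ := by simp only [mul_assoc]
    _ = r • 1 := by rw [hd, mul_smul_comm, mul_one, smul_mul_assoc, hh.1]

theorem exists_cubicForm {p : MvPolynomial (Fin 3) ℝ} (hp : p.IsHomogeneous 4)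
    (hharm : lap p = 0) {r : ℝ} (hd : d2 p = r • (1 : Matrix (Fin 3) (Fin 3) ℝ)) :
    ∃ h ∈ SO3, ∃ s : ℝ, ∀ x, eval (h.mulVec x) p = s * cubicForm x := by
  obtain ⟨g, hg, hmax⟩ := exists_SO3_max p ![0, 0, 1]
  obtain ⟨k, hk, s, hs⟩ := exists_cubicForm_of_max (isHomogeneous_rotPoly g hp)
    (by rw [lap_rotPoly hg.1, hharm, map_zero]) (d2_rotPoly_of_eq_smul hg hd) hmax
  exact ⟨g * k, SO3.mul_mem hg hk, s, fun x => by
    rw [← hs, eval_rotPoly, Matrix.mulVec_mulVec]⟩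

theorem fixesPoly_conj_iff_cubicForm {h g : Matrix (Fin 3) (Fin 3) ℝ} (hh : h ∈ SO3)
    {p : MvPolynomial (Fin 3) ℝ} {s : ℝ} (hs : ∀ x, eval (h.mulVec x) p = s * cubicForm x) :
    fixesPoly (h * g * h⁻¹) p ↔ ∀ x, s * cubicForm (g⁻¹.mulVec x) = s * cubicForm x := by
  rw [fixesPoly_conj hh]
  simp only [fixesPoly, eval_rotPoly, hs]

theorem fixesPoly_conj_of_mem_Octa {h g : Matrix (Fin 3) (Fin 3) ℝ} (hh : h ∈ SO3)
    {p : MvPolynomial (Fin 3) ℝ} {s : ℝ} (hs : ∀ x, eval (h.mulVec x) p = s * cubicForm x)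
    (hg : g ∈ Octa) : fixesPoly (h * g * h⁻¹) p :=
  (fixesPoly_conj_iff_cubicForm hh hs).2 fun x => by rw [cubicForm_inv_mulVec hg]

theorem exists_d2_eq_smul_of_fixesPoly_conj {h : Matrix (Fin 3) (Fin 3) ℝ} (hh : h ∈ SO3)
    {p : MvPolynomial (Fin 3) ℝ} (hfix : ∀ g ∈ Octa, fixesPoly (h * g * h⁻¹) p) :
    ∃ r : ℝ, d2 p = r • (1 : Matrix (Fin 3) (Fin 3) ℝ) := by
  obtain ⟨r, hr⟩ := exists_d2_eq_smul_of_octa fun g hg => (fixesPoly_conj hh g p).1 (hfix g hg)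
  exact ⟨r, d2_eq_smul_of_rotPoly hh hr⟩

/-- For a harmonic homogeneous degree-4 polynomial `p` representing a
harmonic fourth-order tensor `H`: (i) `H` is cubic or isotropic (a conjugate of the
octahedral group fixes `p`) iff (ii) `d₂(p)` is a scalar multiple of the identity.
Moreover `H` is isotropic (`p = 0`) iff `d₂(p) = 0`, and `H` is cubic (its stabilizer is a
conjugate of `𝕆`) iff `d₂(p)` is a nonzero scalar multiple of the identity. -/
theorem cubic_or_isotropic_iff_d2_isotropic
    (p : MvPolynomial (Fin 3) ℝ) (hp : p.IsHomogeneous 4) (hharm : lap p = 0) :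
    ((∃ h ∈ SO3, ∀ g ∈ Octa, fixesPoly (h * g * h⁻¹) p) ↔
        ∃ r : ℝ, d2 p = r • (1 : Matrix (Fin 3) (Fin 3) ℝ)) ∧
    (p = 0 ↔ d2 p = 0) ∧
    ((∃ h ∈ SO3, {g | g ∈ SO3 ∧ fixesPoly g p} = (fun g => h * g * h⁻¹) '' Octa) ↔
        ∃ r : ℝ, r ≠ 0 ∧ d2 p = r • (1 : Matrix (Fin 3) (Fin 3) ℝ)) := by
  refine ⟨⟨fun ⟨h, hh, hfix⟩ => exists_d2_eq_smul_of_fixesPoly_conj hh hfix, fun ⟨r, hr⟩ => ?_⟩,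
    eq_zero_iff_d2_eq_zero hp, ⟨fun ⟨h, hh, hset⟩ => ?_, fun ⟨r, hr0, hr⟩ => ?_⟩⟩
  · obtain ⟨h, hh, s, hs⟩ := exists_cubicForm hp hharm hr
    exact ⟨h, hh, fun g hg => fixesPoly_conj_of_mem_Octa hh hs hg⟩
  · obtain ⟨r, hr⟩ := exists_d2_eq_smul_of_fixesPoly_conj hh
      fun g hg => (hset.symm.subset ⟨g, hg, rfl⟩ : h * g * h⁻¹ ∈ {g | g ∈ SO3 ∧ fixesPoly g p}).2
    refine ⟨r, ?_, hr⟩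
    rintro rfl
    obtain rfl : p = 0 := (eq_zero_iff_d2_eq_zero hp).2 (by rw [hr, zero_smul])
    obtain ⟨g, hg, hgO⟩ := exists_mem_SO3_notMem_Octa
    obtain ⟨k, hk, hkg⟩ := hset.subset
      ⟨SO3.mul_mem (SO3.mul_mem hh hg) (SO3.inv_mem hh), fun x => by simp⟩
    have hu := SO3.isUnit_det hh
    have hu' : IsUnit h := (Matrix.isUnit_iff_isUnit_det h).2 hu
    have hkg' : h * k = h * g := by
      have := congrArg (· * h) hkg
      simpa only [mul_assoc, Matrix.nonsing_inv_mul h hu, mul_one] using this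
    exact hgO (hu'.mul_left_cancel hkg' ▸ hk)
  · obtain ⟨h, hh, s, hs⟩ := exists_cubicForm hp hharm hr
    have hu := SO3.isUnit_det hh
    have hs0 : s ≠ 0 := by
      rintro rfl
      obtain rfl : p = 0 := MvPolynomial.funext fun x => by
        have := hs (h⁻¹.mulVec x)
        rwa [Matrix.mulVec_mulVec, Matrix.mul_nonsing_inv h hu, Matrix.one_mulVec, zero_mul,
          ← map_zero (eval x)] at this
      rw [(eq_zero_iff_d2_eq_zero hp).1 rfl] at hr
      exact hr0 (by simpa using (congrFun (congrFun hr 0) 0).symm)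
    refine ⟨h, hh, Set.ext fun G => ⟨fun ⟨hG, hfix⟩ => ?_, ?_⟩⟩
    · have hconj : h * (h⁻¹ * G * h) * h⁻¹ = G := by
        rw [← mul_assoc, ← mul_assoc, Matrix.mul_nonsing_inv h hu, one_mul, mul_assoc,
          Matrix.mul_nonsing_inv h hu, mul_one]
      refine ⟨h⁻¹ * G * h, mem_Octa_of_cubicForm
        (SO3.mul_mem (SO3.mul_mem (SO3.inv_mem hh) hG) hh) fun x => ?_, hconj⟩
      rw [← hconj] at hfix
      exact mul_left_cancel₀ hs0 ((fixesPoly_conj_iff_cubicForm hh hs).1 hfix x)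
    · rintro ⟨g, hg, rfl⟩
      exact ⟨SO3.mul_mem (SO3.mul_mem hh hg.1) (SO3.inv_mem hh),
        fixesPoly_conj_of_mem_Octa hh hs hg⟩
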